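/- arXiv:2105.13049 — 2 statements merged into one kernel-verified Lean document; each statement's English description precedes it below -/
import Mathlib

section
/- (Molien's formula for S_n.) For |q| < 1 (or as formal power series in ℚ[[q]]), (1/n!) · ∑_{σ ∈ S_n} 1/det(I_n - q·M_σ) = ∏_{k=1}^n 1/(1 - q^k). -/
open Polynomial Matrix

section MolienAux
open Finset Equiv Equiv.Perm

variable {K : Type*} [Field K]

/-- weighted characteristic determinant of a permutation -/
noncomputable def wdet {α : Type*} [Fintype α] [DecidableEq α] (σ : Perm α) (x : α → K) : K :=
  Matrix.det (Matrix.of fun i j : α =>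
    (if i = j then (1 : K) else 0) - x i * (if σ i = j then 1 else 0))

lemma wdet_full {α : Type*} [Fintype α] [DecidableEq α] [Nonempty α] (σ : Perm α) (x : α → K)
    (h : ∀ i j, σ.SameCycle i j) : wdet σ x = 1 - ∏ i, x i := by
  by_cases h1 : σ = 1
  · subst h1
    have : Subsingleton α := ⟨fun i j => by simpa using h i j⟩
    obtain ⟨i0⟩ := ‹Nonempty α›
    let : Unique α := { default := i0, uniq := fun j => Subsingleton.elim _ _ }
    simp [wdet, Matrix.det_unique]
  have hne : ∀ i, σ i ≠ i := by
    intro i hi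
    apply h1
    ext j
    obtain ⟨k, hk⟩ := h i j
    have : (σ ^ k) i = i := by
      exact Equiv.Perm.zpow_apply_eq_self_of_apply_eq_self hi k
    rw [← hk, this]
    simpa using hi
  have hc : σ.IsCycle := by
    obtain ⟨i⟩ := ‹Nonempty α›
    exact ⟨i, hne i, fun j _ => h i j⟩
  have hs : σ.support = Finset.univ := by
    ext i; simp [hne i]
  unfold wdet
  rw [← Matrix.det_transpose, Matrix.det_apply']
  rw [Finset.sum_eq_add (1 : Perm α) σ (Ne.symm h1)]
  · simp [Matrix.transpose_apply, hne, hc.sign, hs, fun i => (hne i).symm]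
    rw [Finset.prod_neg]
    simp [← mul_assoc, ← mul_pow, sub_eq_add_neg]
  · rintro τ - ⟨h2, h3⟩
    by_contra hcon
    have hall : ∀ i, τ i = i ∨ τ i = σ i := by
      intro i
      by_contra hh
      push Not at hh
      apply hcon
      rw [Finset.prod_eq_zero (Finset.mem_univ i), mul_zero]
      simp [Matrix.transpose_apply, hh.1.symm, hh.2.symm]
    apply h3
    have : ∃ i, τ i ≠ i := by
      by_contra hh
      push Not at hh
      exact h2 (Equiv.ext hh)
    obtain ⟨i, hi⟩ := this
    have key : ∀ k : ℕ, τ ((σ ^ k) i) ≠ (σ ^ k) i := by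
      intro k
      induction k with
      | zero => simpa
      | succ k ih =>
        intro hk
        have e : τ ((σ ^ k) i) = σ ((σ ^ k) i) := (hall _).resolve_left ih
        rw [pow_succ', Equiv.Perm.mul_apply, ← e] at hk
        exact ih (τ.injective hk)
    ext j
    obtain ⟨k, hk⟩ := (h i j).exists_nat_pow_eq
    have := key k
    rw [hk] at this
    exact (hall j).resolve_left this
  · simp
  · simp

lemma wdet_subtype {α : Type*} [Fintype α] [DecidableEq α] (σ : Perm α) (x : α → K)
    (p : α → Prop) [DecidablePred p] (h : ∀ i, p (σ i) ↔ p i) :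
    Matrix.det (Matrix.toSquareBlockProp (Matrix.of fun i j : α =>
    (if i = j then (1 : K) else 0) - x i * (if σ i = j then 1 else 0)) p) =
      wdet (σ.subtypePerm h) (fun i => x i) := by
  unfold wdet
  congr 1
  ext i j
  simp [Matrix.toSquareBlockProp, Subtype.ext_iff]

/-- cycles -/
abbrev Cyc {α : Type*} (σ : Perm α) := Quotient (SameCycle.setoid σ)

open Classical in
lemma wdet_eq_prod {α : Type*} [Fintype α] [DecidableEq α] (σ : Perm α) (x : α → K) :
    wdet σ x = ∏ c : Cyc σ, (1 - ∏ i : α with (Quotient.mk _ i : Cyc σ) = c, x i) := by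
  let : LinearOrder (Cyc σ) := LinearOrder.lift' (Fintype.equivFin (Cyc σ)) (Equiv.injective _)
  have hσ : ∀ (c : Cyc σ) (i : α), (Quotient.mk _ (σ i) : Cyc σ) = c ↔ (Quotient.mk _ i : Cyc σ) = c := by
    intro c i
    have : (Quotient.mk _ (σ i) : Cyc σ) = Quotient.mk _ i :=
      Quotient.sound (sameCycle_apply_left.2 (SameCycle.refl σ i))
    rw [this]
  unfold wdet
  rw [Matrix.BlockTriangular.det_fintype (b := fun i : α => (Quotient.mk _ i : Cyc σ))]
  · refine Finset.prod_congr (by ext; simp) fun c _ => ?_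
    have := wdet_subtype σ x (fun i => (Quotient.mk _ i : Cyc σ) = c) (hσ c)
    have hn : Nonempty {i : α // (Quotient.mk _ i : Cyc σ) = c} := by
      obtain ⟨i, rfl⟩ := Quotient.exists_rep c
      exact ⟨⟨i, rfl⟩⟩
    rw [wdet_full] at this
    · rw [Matrix.toSquareBlock]
      convert this using 2
      exact Finset.prod_subtype _ (by simp) _
    · intro i j
      rw [sameCycle_subtypePerm]
      exact Quotient.exact (i.2.trans j.2.symm)
  · intro i j hij
    have h1 : i ≠ j := by rintro rfl; exact lt_irrefl _ hij
    have h2 : σ i ≠ j := by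
      rintro rfl
      have := (hσ (Quotient.mk _ i) i).2 rfl
      simp only [this] at hij
      exact lt_irrefl _ hij
    simp [h1, h2]


open Classical in
lemma wdet_inv_expand {α : Type*} [Fintype α] [DecidableEq α] (σ : Perm α) (q : K)
    (hq : ∀ k : ℕ, k ≠ 0 → q ^ k ≠ 1) :
    (wdet σ (fun _ => q))⁻¹ = ∑ Z : Finset α with (∀ i, σ i ∈ Z ↔ i ∈ Z),
      q ^ #Z * (wdet σ (fun i => if i ∈ Z then q else 0))⁻¹ := by
  set m : α → Cyc σ := fun i => Quotient.mk _ i with hm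
  set N : Cyc σ → ℕ := fun c => #{i : α | m i = c} with hN
  have hmσ : ∀ i, m (σ i) = m i := fun i =>
    Quotient.sound (sameCycle_apply_left.2 (SameCycle.refl σ i))
  have hN0 : ∀ c, N c ≠ 0 := by
    intro c
    obtain ⟨i, rfl⟩ := Quotient.exists_rep c
    exact Finset.card_ne_zero_of_mem (a := i) (by simp [hm])
  have h1 : (wdet σ (fun _ => q))⁻¹ = ∏ c : Cyc σ, (1 + q ^ N c * (1 - q ^ N c)⁻¹) := by
    rw [wdet_eq_prod, ← Finset.prod_inv_distrib]
    refine Finset.prod_congr rfl fun c _ => ?_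
    rw [Finset.prod_const]
    have : 1 - q ^ N c ≠ 0 := sub_ne_zero.2 (hq _ (hN0 c)).symm
    change (1 - q ^ N c)⁻¹ = _
    field_simp
    ring
  rw [h1, Finset.prod_one_add]
  have hinv : ∀ Z : Finset α, (∀ i, σ i ∈ Z ↔ i ∈ Z) → ∀ i j, m i = m j → (i ∈ Z → j ∈ Z) := by
    intro Z hZ i j hij hi
    obtain ⟨k, rfl⟩ := (Quotient.exact hij : σ.SameCycle i j).exists_nat_pow_eq
    clear hij
    induction k with
    | zero => simpa
    | succ k ih => rw [pow_succ', Equiv.Perm.mul_apply, hZ]; exact ih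
  refine Finset.sum_bij' (fun T _ => ({i : α | m i ∈ T} : Finset α)) (fun Z _ => Z.image m)
    ?_ ?_ ?_ ?_ ?_
  · intro T _
    simp [hmσ]
  · simp
  · intro T _
    ext c
    obtain ⟨i, rfl⟩ := Quotient.exists_rep c
    simp only [Finset.mem_image, Finset.mem_filter, Finset.mem_univ, true_and]
    constructor
    · rintro ⟨j, hj, hji⟩
      rw [← hji]; exact hj
    · intro h
      exact ⟨i, h, rfl⟩
  · intro Z hZ
    ext i
    simp only [Finset.mem_image, Finset.mem_filter, Finset.mem_univ, true_and] at hZ ⊢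
    constructor
    · rintro ⟨j, hj, hji⟩
      exact hinv Z hZ j i hji hj
    · intro h
      exact ⟨i, h, rfl⟩
  · intro T _
    rw [Finset.prod_mul_distrib]
    congr 1
    · rw [Finset.prod_pow_eq_pow_sum]
      congr 1
      rw [Finset.card_eq_sum_card_fiberwise (f := m) (t := T)]
      · refine Finset.sum_congr rfl fun c hc => ?_
        refine congrArg Finset.card ?_
        ext i
        simp only [Finset.mem_filter, Finset.mem_univ, true_and]
        constructor
        · intro h; exact ⟨h ▸ hc, h⟩
        · exact fun h => h.2
      · intro i hi
        simpa using hi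
    · rw [wdet_eq_prod, Finset.prod_inv_distrib]
      congr 1
      rw [← Finset.prod_subset (Finset.subset_univ T)]
      · refine Finset.prod_congr rfl fun c hc => ?_
        rw [Finset.prod_congr rfl (g := fun _ => q), Finset.prod_const]
        intro i hi
        have hi' : m i = c := by simpa using hi
        simp [hi', hc]
      · intro c _ hc
        obtain ⟨i, rfl⟩ := Quotient.exists_rep c
        have hi : m i ∉ T := hc
        rw [Finset.prod_eq_zero (i := i)]
        · simp
        · simp
        · simp [hi]

/-- the sum of inverse determinants over a symmetric group -/
noncomputable def molA (q : K) (n : ℕ) : K :=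
  ∑ σ : Perm (Fin n), (wdet σ (fun _ => q))⁻¹

lemma molA_card {α : Type*} [Fintype α] [DecidableEq α] (q : K) :
    ∑ σ : Perm α, (wdet σ (fun _ => q))⁻¹ = molA q (Fintype.card α) := by
  unfold molA
  let e := Fintype.equivFin α
  refine Fintype.sum_equiv e.permCongr _ _ fun σ => ?_
  congr 1
  unfold wdet
  rw [← Matrix.det_reindex_self e]
  congr 1
  ext i j
  simp [Matrix.reindex_apply, Equiv.permCongr_apply, Equiv.eq_symm_apply]
  by_cases h : e (σ (e.symm i)) = j <;> simp [h]

lemma wdet_congr_part {α : Type*} [Fintype α] [DecidableEq α] (q : K) (p : α → Prop) [DecidablePred p]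
    (e : Perm {i // p i}) (f : Perm {i // ¬ p i}) :
    wdet (Equiv.Perm.subtypeCongr e f) (fun i => if p i then q else 0) =
      wdet e (fun _ => q) := by
  have he : ∀ i : {i // p i}, Equiv.Perm.subtypeCongr e f i = e i := fun i =>
    Equiv.Perm.subtypeCongr.left_apply_subtype e f i
  generalize Equiv.Perm.subtypeCongr e f = σ at he
  unfold wdet
  rw [Matrix.twoBlockTriangular_det _ (fun i => p i)]
  · have e2 : (Matrix.toSquareBlockProp (Matrix.of fun i j : α =>
        (if i = j then (1 : K) else 0) - (if p i then q else 0) *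
          (if σ i = j then 1 else 0)) (fun i => ¬ p i)) = 1 := by
      ext i j
      simp [Matrix.toSquareBlockProp, i.2, Matrix.one_apply, Subtype.ext_iff]
    rw [e2, Matrix.det_one, mul_one]
    refine congrArg Matrix.det ?_
    ext i j
    have hi : p i := i.2
    simp [Matrix.toSquareBlockProp, Subtype.ext_iff, he, hi]
  · intro i hi j hj
    have : i ≠ j := by rintro rfl; exact hi hj
    simp [hi, this]

lemma molA_part {n : ℕ} (q : K) (p : Fin n → Prop) [DecidablePred p] :
    ∑ σ : Perm (Fin n) with (∀ i, p (σ i) ↔ p i),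
      (wdet σ (fun i => if p i then q else 0))⁻¹ = ((n - Fintype.card {i // p i}).factorial : K) * molA q (Fintype.card {i // p i}) := by
  have h1 : ∑ P : Perm {i // p i} × Perm {i // ¬ p i}, (wdet P.1 (fun _ => q))⁻¹ =
      ((n - Fintype.card {i // p i}).factorial : K) * molA q (Fintype.card {i // p i}) := by
    rw [Fintype.sum_prod_type]
    simp only [Finset.sum_const, Finset.card_univ, Fintype.card_perm, nsmul_eq_mul]
    rw [← Finset.mul_sum, molA_card, Fintype.card_subtype_compl]
    simp
  rw [← h1]
  symm
  refine Finset.sum_bij (fun P _ => Equiv.Perm.subtypeCongr P.1 P.2) ?_ ?_ ?_ ?_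
  · intro P _
    simp only [Finset.mem_filter, Finset.mem_univ, true_and]
    intro i
    by_cases hi : p i
    · rw [Equiv.Perm.subtypeCongr.left_apply _ _ hi]
      simp [hi, (P.1 ⟨i, hi⟩).2]
    · rw [Equiv.Perm.subtypeCongr.right_apply _ _ hi]
      simp only [hi, iff_false]
      exact (P.2 ⟨i, hi⟩).2
  · intro a _ b _ h
    exact Equiv.Perm.subtypeCongrHom_injective (fun i => p i) h
  · intro σ hσ
    simp only [Finset.mem_filter, Finset.mem_univ, true_and] at hσ
    refine ⟨(σ.subtypePerm hσ, σ.subtypePerm (p := fun i => ¬ p i) fun i => not_congr (hσ i)),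
      Finset.mem_univ _, ?_⟩
    ext i
    by_cases hi : p i
    · rw [Equiv.Perm.subtypeCongr.left_apply _ _ hi]
      simp
    · rw [Equiv.Perm.subtypeCongr.right_apply _ _ hi]
      simp
  · intro P _
    rw [wdet_congr_part]

open Classical in
lemma molA_rec (n : ℕ) (q : K) (hq : ∀ k : ℕ, k ≠ 0 → q ^ k ≠ 1) :
    molA q n = ∑ j ∈ Finset.range (n + 1),
      (n.choose j : K) * (q ^ j * ((n - j).factorial * molA q j)) := by
  have h1 : molA q n = ∑ Z ∈ (Finset.univ : Finset (Fin n)).powerset,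
      q ^ #Z * ((n - #Z).factorial * molA q #Z) := by
    rw [molA, Finset.sum_congr rfl fun σ _ => wdet_inv_expand σ q hq]
    simp only [Finset.sum_filter]
    rw [Finset.sum_comm]
    simp only [Finset.powerset_univ]
    refine Finset.sum_congr rfl fun Z _ => ?_
    have h := molA_part q (fun i => i ∈ Z)
    rw [Fintype.card_coe] at h
    rw [← h, Finset.sum_filter, Finset.mul_sum]
    refine Finset.sum_congr rfl fun σ _ => ?_
    split_ifs <;> simp
  rw [h1, Finset.sum_powerset_apply_card (fun j => q ^ j * ((n - j).factorial * molA q j))]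
  simp

lemma molA_eq [CharZero K] (n : ℕ) (q : K) (hq : ∀ k : ℕ, k ≠ 0 → q ^ k ≠ 1) :
    (n.factorial : K)⁻¹ * molA q n = ∏ k ∈ Finset.range n, (1 - q ^ (k + 1))⁻¹ := by
  have hB : ∀ n : ℕ, (n.factorial : K)⁻¹ * molA q n =
      ∑ j ∈ Finset.range (n + 1), q ^ j * ((j.factorial : K)⁻¹ * molA q j) := by
    intro n
    conv_lhs => rw [molA_rec n q hq]
    rw [Finset.mul_sum]
    refine Finset.sum_congr rfl fun j hj => ?_
    have hj' : j ≤ n := by simpa [Nat.lt_succ_iff] using hj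
    rw [Nat.cast_choose K hj']
    have a1 : (n.factorial : K) ≠ 0 := by exact_mod_cast n.factorial_ne_zero
    have a2 : (j.factorial : K) ≠ 0 := by exact_mod_cast j.factorial_ne_zero
    have a3 : ((n - j).factorial : K) ≠ 0 := by exact_mod_cast (n - j).factorial_ne_zero
    field_simp
  induction n with
  | zero => simp [molA, wdet]
  | succ n ih =>
    rw [Finset.prod_range_succ, ← ih]
    have h := hB (n + 1)
    rw [Finset.sum_range_succ, ← hB n] at h
    have h0 : 1 - q ^ (n + 1) ≠ 0 := sub_ne_zero.2 (hq _ n.succ_ne_zero).symm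
    rw [eq_mul_inv_iff_mul_eq₀ h0]
    linear_combination h

end MolienAux

/-- Molien's formula for `S_n`:
`(1/n!) ∑_{σ ∈ S_n} 1/det(I - q M_σ) = ∏_{k=1}^n 1/(1 - q^k)`,
as an identity of rational functions in `q` (the field of fractions of `ℚ[q]`,
into which `ℚ[[q]]`-identities between rational series embed). -/
theorem molien_formula_symmetric_group (n : ℕ) (hn : 1 ≤ n) :
    ((n.factorial : ℚ)⁻¹ : ℚ) •
        ∑ σ : Equiv.Perm (Fin n),
          (algebraMap ℚ[X] (RatFunc ℚ)
            (Matrix.det ((1 : Matrix (Fin n) (Fin n) ℚ[X]) -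
              (X : ℚ[X]) • σ.permMatrix ℚ[X])))⁻¹ =
      ∏ k ∈ Finset.range n,
        (1 - (RatFunc.X : RatFunc ℚ) ^ (k + 1))⁻¹ := by
  have hq : ∀ k : ℕ, k ≠ 0 → (RatFunc.X : RatFunc ℚ) ^ k ≠ 1 := by
    intro k hk h
    rw [← RatFunc.algebraMap_X, ← map_pow, ← map_one (algebraMap ℚ[X] (RatFunc ℚ))] at h
    have h2 := RatFunc.algebraMap_injective ℚ h
    have h3 := congrArg Polynomial.natDegree h2
    simp at h3
    exact hk h3
  have : CharZero (RatFunc ℚ) := algebraRat.charZero _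
  rw [← molA_eq n _ hq, molA]
  rw [RatFunc.smul_eq_C_smul, Algebra.smul_def, RatFunc.algebraMap_C, map_inv₀, map_natCast]
  congr 1
  · refine Finset.sum_congr rfl fun σ _ => ?_
    congr 1
    rw [wdet, RingHom.map_det]
    congr 1
    ext i j
    have hp : (algebraMap ℚ[X] (RatFunc ℚ)) (if σ i = j then X else 0) =
        RatFunc.X * (if σ i = j then 1 else 0) := by
      split_ifs <;> simp
    have ho : (algebraMap ℚ[X] (RatFunc ℚ)) (if i = j then 1 else 0) =
        (if i = j then 1 else 0) := by
      split_ifs <;> simp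
    have hm : ((1 : Matrix (Fin n) (Fin n) ℚ[X]) - (X : ℚ[X]) • σ.permMatrix ℚ[X]) i j =
        (if i = j then 1 else 0) - (if σ i = j then X else 0) := by
      simp [Matrix.one_apply, Equiv.Perm.permMatrix, PEquiv.toMatrix_apply, Equiv.toPEquiv_apply]
    rw [RingHom.mapMatrix_apply, Matrix.map_apply, hm, map_sub, hp, ho, Matrix.of_apply]
end

section
/- (q-binomial/Cauchy identity via permutations.) For every n ≥ 1, (1/n!) · ∑_{σ ∈ S_n} det(I_n - x·M_σ)/det(I_n - q·M_σ) = ∏_{k=1}^n (1 - x·q^{k-1})/(1 - q^k), as an identity of formal power series in ℚ[[x, q]] (or rational functions in x, q). -/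
open Matrix

/-- Rows of the permutation matrix restricted to the support. -/
def suppMat {n F : Type*} [DecidableEq n] [CommRing F] (σ : Equiv.Perm n) : Matrix n n F :=
  Matrix.of fun i j => if σ i = i then 0 else if σ i = j then 1 else 0

lemma suppMat_disjoint {n F : Type*} [DecidableEq n] [Fintype n] [CommRing F] (x : F)
    {σ τ : Equiv.Perm n} (h : σ.Disjoint τ) :
    (1 : Matrix n n F) - x • suppMat (σ * τ) = (1 - x • suppMat σ) * (1 - x • suppMat τ) := by
  have h1 : (suppMat σ : Matrix n n F) * suppMat τ = 0 := by
    ext i j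
    rw [Matrix.mul_apply]
    apply Finset.sum_eq_zero
    intro k _
    by_cases h2 : σ i = i
    · simp [suppMat, h2]
    · by_cases h3 : σ i = k
      · have : σ k ≠ k := by
          subst h3
          intro h4
          exact h2 (σ.injective h4)
        have h5 : τ k = k := (h k).resolve_left this
        simp [suppMat, h5]
      · simp [suppMat, h3]
  have h2 : (suppMat (σ * τ) : Matrix n n F) = suppMat σ + suppMat τ := by
    ext i j
    rcases h i with h3 | h3
    · by_cases h4 : τ i = i
      · simp [suppMat, h3, h4]
      · have : τ (τ i) ≠ τ i := fun h5 => h4 (τ.injective h5)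
        have h6 : σ (τ i) = τ i := (h _).resolve_right this
        simp [suppMat, h3, h6]
    · simp [suppMat, h3]
  rw [sub_mul, mul_sub, mul_sub, Matrix.smul_mul x (suppMat σ) (x • suppMat τ),
    Matrix.mul_smul (suppMat σ), h1, h2]
  simp only [smul_add, smul_zero, mul_one, one_mul]
  abel

lemma suppMat_cycle {n F : Type*} [DecidableEq n] [Fintype n] [CommRing F] (x : F)
    {σ : Equiv.Perm n} (h : σ.IsCycle) :
    ((1 : Matrix n n F) - x • suppMat σ).det = 1 - x ^ σ.support.card := by
  rw [← Matrix.det_transpose, Matrix.det_apply']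
  have hne : (1 : Equiv.Perm n) ≠ σ := fun h1 => h.ne_one h1.symm
  have key : ∀ τ ∈ (Finset.univ : Finset (Equiv.Perm n)), τ ∉ ({1, σ} : Finset (Equiv.Perm n)) →
      ((Equiv.Perm.sign τ : ℤ) : F) * ∏ i, ((1 : Matrix n n F) - x • suppMat σ)ᵀ (τ i) i = 0 := by
    intro τ _ hτ
    by_contra hc
    apply hτ
    have h2 : ∀ i, τ i = i ∨ τ i = σ i := by
      intro i
      by_contra h3
      push Not at h3
      apply hc
      rw [Finset.prod_eq_zero (Finset.mem_univ i), mul_zero]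
      simp [suppMat, Matrix.one_apply, h3.1.symm, h3.2.symm]
    have h3 : ∀ i, τ (σ i) = σ i → τ i = i := by
      intro i hi
      rcases h2 i with h4 | h4
      · exact h4
      · rw [← h4] at hi
        exact τ.injective hi
    simp only [Finset.mem_insert, Finset.mem_singleton]
    by_cases h4 : ∃ i, σ i ≠ i ∧ τ i = i
    · left
      obtain ⟨i, hi, hti⟩ := h4
      have h5 : ∀ k : ℕ, ∀ j, (σ ^ k) j = i → τ j = j := by
        intro k
        induction k with
        | zero => intro j hj; simp at hj; rw [hj, hti]
        | succ k ih =>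
          intro j hj
          rw [pow_succ, Equiv.Perm.mul_apply] at hj
          exact h3 j (ih _ hj)
      ext j
      rw [Equiv.Perm.one_apply]
      by_cases hj : σ j = j
      · rcases h2 j with h6 | h6
        · exact h6
        · rw [h6, hj]
      · obtain ⟨k, hk⟩ := (h.sameCycle hj hi).exists_pow_eq'
        exact h5 k j hk.2
    · right
      push Not at h4
      ext j
      rcases h2 j with h6 | h6
      · by_cases hj : σ j = j
        · rw [h6, hj]
        · exact absurd h6 (h4 j hj)
      · rw [h6]
  rw [← Finset.sum_subset (Finset.subset_univ ({1, σ} : Finset (Equiv.Perm n))) key,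
    Finset.sum_pair hne]
  have e1 : ∏ i, ((1 : Matrix n n F) - x • suppMat σ)ᵀ ((1 : Equiv.Perm n) i) i = 1 := by
    apply Finset.prod_eq_one
    intro i _
    by_cases hi : σ i = i <;> simp [suppMat, hi]
  have e2 : ∏ i, ((1 : Matrix n n F) - x • suppMat σ)ᵀ (σ i) i = (-x) ^ σ.support.card := by
    rw [← Finset.prod_const, ← Finset.prod_subset (Finset.subset_univ σ.support)]
    · apply Finset.prod_congr rfl
      intro i hi
      rw [Equiv.Perm.mem_support] at hi
      simp [suppMat, hi, Matrix.one_apply, hi.symm]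
    · intro i _ hi
      rw [Equiv.Perm.notMem_support] at hi
      simp [suppMat, hi]
  rw [e1, e2, h.sign]
  simp only [Equiv.Perm.sign_one, Units.val_one, Int.cast_one, mul_one, Units.val_neg,
    Units.val_pow_eq_pow_val, Int.cast_neg, Int.cast_pow]
  rw [neg_mul, ← mul_pow]
  simp [sub_eq_add_neg]

lemma suppMat_det {n F : Type*} [DecidableEq n] [Fintype n] [CommRing F] (x : F)
    (σ : Equiv.Perm n) :
    ((1 : Matrix n n F) - x • suppMat σ).det = (σ.cycleType.map fun k => 1 - x ^ k).prod := by
  induction σ using Equiv.Perm.cycle_induction_on with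
  | base_one =>
    have : (suppMat (1 : Equiv.Perm n) : Matrix n n F) = 0 := by ext i j; simp [suppMat]
    simp [this]
  | base_cycles σ h => rw [suppMat_cycle x h, h.cycleType]; simp
  | induction_disjoint σ τ hd hc h1 h2 =>
    rw [suppMat_disjoint x hd, Matrix.det_mul, h1, h2, hd.cycleType_mul, Multiset.map_add,
      Multiset.prod_add]

lemma permMat_det {n F : Type*} [DecidableEq n] [Fintype n] [CommRing F] (x : F)
    (σ : Equiv.Perm n) :
    ((1 : Matrix n n F) - x • σ.permMatrix F).det =
      (σ.partition.parts.map fun k => 1 - x ^ k).prod := by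
  have h : (1 : Matrix n n F) - x • σ.permMatrix F =
      Matrix.diagonal (fun i => if σ i = i then 1 - x else 1) * (1 - x • suppMat σ) := by
    ext i j
    rw [Matrix.diagonal_mul]
    by_cases hi : σ i = i
    · simp [suppMat, hi, PEquiv.toMatrix_apply, Matrix.one_apply]
      split_ifs <;> simp
    · simp [suppMat, hi, PEquiv.toMatrix_apply, Matrix.one_apply]
  rw [h, Matrix.det_mul, suppMat_det, Matrix.det_diagonal, Equiv.Perm.parts_partition,
    Multiset.map_add, Multiset.prod_add, mul_comm]
  congr 1
  rw [Finset.prod_ite]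
  simp only [Finset.prod_const, Finset.prod_const_one, mul_one, Multiset.map_replicate,
    Multiset.prod_replicate, pow_one]
  congr 1
  rw [← Finset.card_compl, one_pow, mul_one]
  congr 2
  ext i
  simp

/-- z-weight of a multiset. -/
noncomputable def zw {F : Type*} [Field F] (p : ℕ → F) (s : Multiset ℕ) : F :=
  (s.map p).prod / ((s.prod : F) * ∏ k ∈ s.toFinset, ((s.count k).factorial : F))

lemma zw_cons {F : Type*} [Field F] [CharZero F] (p : ℕ → F) (s : Multiset ℕ) (k : ℕ) (hk : k ≠ 0) :
    ((k * (k ::ₘ s).count k : ℕ) : F) * zw p (k ::ₘ s) = p k * zw p s := by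
  have h : ∏ j ∈ (k ::ₘ s).toFinset, (((k ::ₘ s).count j).factorial : F) =
      ((k ::ₘ s).count k : F) * ∏ j ∈ s.toFinset, ((s.count j).factorial : F) := by
    have h1 : ∏ j ∈ s.toFinset, ((s.count j).factorial : F) =
        ∏ j ∈ (k ::ₘ s).toFinset, ((s.count j).factorial : F) := by
      apply Finset.prod_subset
      · intro j hj; simp at hj ⊢; right; exact hj
      · intro j _ hj
        simp at hj
        simp [Multiset.count_eq_zero_of_notMem hj]
    have hk : k ∈ (k ::ₘ s).toFinset := by simp
    rw [h1, ← Finset.mul_prod_erase _ _ hk, ← Finset.mul_prod_erase _ _ hk, ← mul_assoc]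
    congr 1
    · rw [Multiset.count_cons_self, Nat.factorial_succ]; push_cast; rfl
    · apply Finset.prod_congr rfl
      intro j hj
      rw [Multiset.count_cons_of_ne (Finset.ne_of_mem_erase hj)]
  unfold zw
  rw [h, Multiset.map_cons, Multiset.prod_cons, Multiset.prod_cons]
  have hk' : (k : F) ≠ 0 := by exact_mod_cast hk
  have hc : ((k ::ₘ s).count k : F) ≠ 0 := by
    rw [Multiset.count_cons_self]; exact_mod_cast Nat.succ_ne_zero (s.count k)
  simp only [Nat.cast_mul]
  rw [mul_div_assoc', show (k:F) * (Multiset.count k (k ::ₘ s) : F) * (p k * (s.map p).prod) =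
    (k * (Multiset.count k (k ::ₘ s) : F)) * (p k * (s.map p).prod) by ring,
    show (k:F) * (s.prod : F) * ((Multiset.count k (k ::ₘ s) : F) * ∏ j ∈ s.toFinset, ((s.count j).factorial : F))
      = (k * (Multiset.count k (k ::ₘ s) : F)) * ((s.prod : F) * ∏ j ∈ s.toFinset, ((s.count j).factorial : F)) by ring,
    mul_div_mul_left _ _ (mul_ne_zero hk' hc), mul_div_assoc]

/-- sum over partitions -/
noncomputable def za {F : Type*} [Field F] (p : ℕ → F) (n : ℕ) : F :=
  ∑ l : Nat.Partition n, zw p l.parts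

lemma za_step {F : Type*} [Field F] [CharZero F] (p : ℕ → F) (m k : ℕ) (hk : k ≠ 0) :
    ∑ l : Nat.Partition (m + k), ((k * l.parts.count k : ℕ) : F) * zw p l.parts = p k * za p m := by
  classical
  have h1 : ∑ l : Nat.Partition (m + k), ((k * l.parts.count k : ℕ) : F) * zw p l.parts =
      ∑ l : Nat.Partition (m + k) with k ∈ l.parts,
        ((k * l.parts.count k : ℕ) : F) * zw p l.parts := by
    symm
    apply Finset.sum_subset (Finset.subset_univ _)
    intro l _ hl
    simp only [Finset.mem_filter, Finset.mem_univ, true_and] at hl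
    simp [Multiset.count_eq_zero_of_notMem hl]
  rw [h1, za, Finset.mul_sum]
  symm
  refine Finset.sum_bij' 
    (fun (μ : Nat.Partition m) _ => (⟨k ::ₘ μ.parts, by
        intro i hi
        rcases Multiset.mem_cons.mp hi with h | h
        · omega
        · exact μ.parts_pos h, by rw [Multiset.sum_cons, μ.parts_sum, add_comm]⟩ : Nat.Partition (m + k)))
    (fun (l : Nat.Partition (m + k)) hl => (⟨l.parts.erase k, fun hi => l.parts_pos (Multiset.mem_of_mem_erase hi), by
        have h2 := l.parts_sum
        rw [← Multiset.cons_erase (Finset.mem_filter.mp hl).2, Multiset.sum_cons] at h2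
        omega⟩ : Nat.Partition m)) ?_ ?_ ?_ ?_ ?_
  · intro μ _; simp
  · intro l _; simp
  · intro μ _; simp
  · intro l hl
    ext1
    exact Multiset.cons_erase (Finset.mem_filter.mp hl).2
  · intro μ _
    exact (zw_cons p μ.parts k hk).symm

lemma za_rec {F : Type*} [Field F] [CharZero F] (p : ℕ → F) (n : ℕ) :
    (n : F) * za p n = ∑ k ∈ Finset.range n, p (k + 1) * za p (n - 1 - k) := by
  have h : ∀ l : Nat.Partition n, (n : F) * zw p l.parts =
      ∑ k ∈ Finset.range n, (((k + 1) * l.parts.count (k + 1) : ℕ) : F) * zw p l.parts := by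
    intro l
    rw [← Finset.sum_mul, ← Nat.cast_sum]
    congr 2
    conv_lhs => rw [← l.parts_sum, Finset.sum_multiset_count]
    rw [Finset.sum_subset (s₂ := (Finset.range n).map ⟨(· + 1), add_left_injective 1⟩)]
    · rw [Finset.sum_map]
      simp [mul_comm]
    · intro i hi
      rw [Multiset.mem_toFinset] at hi
      have h1 := l.parts_pos hi
      have h2 := Multiset.le_sum_of_mem hi
      rw [l.parts_sum] at h2
      simp only [Finset.mem_map, Finset.mem_range, Function.Embedding.coeFn_mk]
      exact ⟨i - 1, by omega, by omega⟩
    · intro i _ hi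
      rw [Multiset.mem_toFinset] at hi
      simp [Multiset.count_eq_zero_of_notMem hi]
  rw [za, Finset.mul_sum, Finset.sum_congr rfl fun l _ => h l, Finset.sum_comm]
  apply Finset.sum_congr rfl
  intro k hk
  rw [Finset.mem_range] at hk
  obtain ⟨m, rfl⟩ : ∃ m, n = m + (k + 1) := ⟨n - (k + 1), by omega⟩
  rw [za_step p m (k + 1) (by omega)]
  congr 2
  omega

lemma perm_card {α : Type*} [Fintype α] [DecidableEq α] (l : Nat.Partition (Fintype.card α)) :
    (Finset.univ.filter fun τ : Equiv.Perm α => τ.partition = l).card *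
      (l.parts.prod * ∏ k ∈ l.parts.toFinset, (l.parts.count k).factorial) =
      (Fintype.card α).factorial := by
  set m := l.parts.filter (fun k => 2 ≤ k) with hm
  have hlm : l.parts = m + Multiset.replicate (Fintype.card α - m.sum) 1 := by
    have h1 : l.parts = m + l.parts.filter (fun k => ¬ 2 ≤ k) :=
      (Multiset.filter_add_not _ _).symm
    have h2 : l.parts.filter (fun k => ¬ 2 ≤ k) =
        Multiset.replicate (l.parts.filter (fun k => ¬ 2 ≤ k)).card 1 := by
      rw [Multiset.eq_replicate_card]
      intro b hb
      rw [Multiset.mem_filter] at hb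
      have := l.parts_pos hb.1
      omega
    have h3 : m.sum + (l.parts.filter (fun k => ¬ 2 ≤ k)).card = Fintype.card α := by
      have h4 := congrArg Multiset.sum h1
      rw [Multiset.sum_add, h2, Multiset.sum_replicate, l.parts_sum] at h4
      simp only [smul_eq_mul, mul_one] at h4
      omega
    have h5 : (l.parts.filter (fun k => ¬ 2 ≤ k)).card = Fintype.card α - m.sum := by omega
    rw [← h5, ← h2]
    exact h1
  have hfil : (Finset.univ.filter fun τ : Equiv.Perm α => τ.partition = l) =
      Finset.univ.filter fun τ : Equiv.Perm α => τ.cycleType = m := by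
    ext τ
    simp only [Finset.mem_filter, Finset.mem_univ, true_and]
    constructor
    · rintro rfl
      rw [hm, Equiv.Perm.filter_parts_partition_eq_cycleType]
    · intro h
      ext1
      rw [Equiv.Perm.parts_partition, ← Equiv.Perm.sum_cycleType, h, ← hlm]
  have hm1 : m.count 1 = 0 := by
    apply Multiset.count_eq_zero_of_notMem
    simp [hm]
  have hm2 : m.sum ≤ Fintype.card α ∧ ∀ a ∈ m, 2 ≤ a := by
    constructor
    · have h4 := congrArg Multiset.sum hlm
      rw [Multiset.sum_add, l.parts_sum] at h4
      omega
    · intro a ha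
      exact (Multiset.mem_filter.mp ha).2
  have hprod : ∏ k ∈ l.parts.toFinset, (l.parts.count k).factorial =
      (Fintype.card α - m.sum).factorial * ∏ k ∈ m.toFinset, (m.count k).factorial := by
    have h1 : (1 : ℕ) ∉ m.toFinset := by simp [hm]
    rw [Finset.prod_subset (s₂ := insert 1 m.toFinset), Finset.prod_insert h1]
    · congr 1
      · rw [hlm, Multiset.count_add, hm1, Multiset.count_replicate_self, zero_add]
      · apply Finset.prod_congr rfl
        intro k hk
        have hk1 : 1 ≠ k := fun h => h1 (h ▸ hk)
        conv_lhs => rw [hlm, Multiset.count_add, Multiset.count_replicate, if_neg hk1, add_zero]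
    · intro k hk
      rw [Multiset.mem_toFinset, hlm, Multiset.mem_add] at hk
      rcases hk with hk | hk
      · simp [hk]
      · simp [Multiset.eq_of_mem_replicate hk]
    · intro k _ hk
      rw [Multiset.mem_toFinset] at hk
      simp [Multiset.count_eq_zero_of_notMem hk]
  have hp : l.parts.prod = m.prod := by
    conv_lhs => rw [hlm]
    simp
  have := Equiv.Perm.card_of_cycleType_mul_eq α m
  rw [if_pos hm2] at this
  rw [hfil, hprod, hp, ← this]
  ring

lemma perm_sum {F : Type*} [Field F] [CharZero F] (p : ℕ → F)
    {α : Type*} [Fintype α] [DecidableEq α] :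
    ∑ σ : Equiv.Perm α, (σ.partition.parts.map p).prod =
      ((Fintype.card α).factorial : F) * za p (Fintype.card α) := by
  rw [← Finset.sum_fiberwise (s := Finset.univ) (g := fun σ : Equiv.Perm α => σ.partition), za,
    Finset.mul_sum]
  apply Finset.sum_congr rfl
  intro l _
  have h1 : ∀ σ ∈ Finset.univ.filter (fun τ : Equiv.Perm α => τ.partition = l),
      (σ.partition.parts.map p).prod = (l.parts.map p).prod := by
    intro σ hσ
    rw [(Finset.mem_filter.mp hσ).2]
  rw [Finset.sum_congr rfl h1, Finset.sum_const, nsmul_eq_mul, zw]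
  have h2 := perm_card l
  have h3 : l.parts.prod * ∏ k ∈ l.parts.toFinset, (l.parts.count k).factorial ≠ 0 := by
    intro h
    rw [h, mul_zero] at h2
    exact Nat.factorial_ne_zero _ h2.symm
  have h4 : ((l.parts.prod : ℕ) : F) *
      ∏ k ∈ l.parts.toFinset, ((l.parts.count k).factorial : F) ≠ 0 := by
    rw [← Nat.cast_prod, ← Nat.cast_mul]
    exact Nat.cast_ne_zero.mpr h3
  rw [← h2, Nat.cast_mul, Nat.cast_mul, Nat.cast_prod, mul_assoc, mul_div_cancel₀ _ h4]

lemma series_unique {F : Type*} [Field F] (x q : F) (hq : ∀ k : ℕ, q ^ (k + 1) ≠ 1)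
    (E : PowerSeries F) (h0 : PowerSeries.coeff 0 E = 0)
    (h : (1 - PowerSeries.X) * E =
      (1 - PowerSeries.C x * PowerSeries.X) * PowerSeries.rescale q E) : E = 0 := by
  ext n
  induction n with
  | zero => simpa using h0
  | succ n ih =>
    have h1 := congrArg (PowerSeries.coeff (n + 1)) h
    rw [sub_mul, sub_mul, map_sub, map_sub, mul_assoc, PowerSeries.coeff_C_mul] at h1
    simp only [one_mul, PowerSeries.coeff_succ_X_mul, PowerSeries.coeff_rescale] at h1
    rw [ih] at h1
    simp only [map_zero, mul_zero, sub_zero] at h1 ⊢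
    have h2 : (q ^ (n + 1) - 1) * PowerSeries.coeff (n + 1) E = 0 := by
      rw [sub_mul, ← h1]; ring
    exact (mul_eq_zero.mp h2).resolve_left (sub_ne_zero.mpr (hq n))

/-- The product side. -/
noncomputable def zb {F : Type*} [Field F] (x q : F) (n : ℕ) : F :=
  ∏ k ∈ Finset.range n, (1 - x * q ^ k) / (1 - q ^ (k + 1))

/-- power sums -/
noncomputable def zp {F : Type*} [Field F] (x q : F) (n : ℕ) : F := (1 - x ^ n) / (1 - q ^ n)

lemma zb_series {F : Type*} [Field F] (x q : F) (hq : ∀ k : ℕ, q ^ (k + 1) ≠ 1) :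
    PowerSeries.X * (PowerSeries.derivative F (PowerSeries.mk (zb x q))) =
      PowerSeries.mk (zp x q) * PowerSeries.mk (zb x q) := by
  set B := PowerSeries.mk (zb x q) with hB
  set P := PowerSeries.mk (zp x q) with hP
  set T : PowerSeries F := PowerSeries.X with hT
  set c : PowerSeries F := PowerSeries.C x with hc
  have f1 : (1 - T) * B = (1 - c * T) * PowerSeries.rescale q B := by
    ext n
    rw [sub_mul, sub_mul, map_sub, map_sub, mul_assoc, PowerSeries.coeff_C_mul]
    cases n with
    | zero => simp [hT]
    | succ n =>
      simp only [one_mul, hT, PowerSeries.coeff_succ_X_mul, PowerSeries.coeff_rescale, hB,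
        PowerSeries.coeff_mk]
      have : 1 - q ^ (n + 1) ≠ 0 := sub_ne_zero.mpr (hq n).symm
      rw [zb, Finset.prod_range_succ, ← zb]
      field_simp
      ring
  have f2 : T * PowerSeries.rescale q (T * PowerSeries.derivative F B) =
      T * (T * PowerSeries.derivative F (PowerSeries.rescale q B)) := by
    congr 1
    ext n
    cases n with
    | zero => simp [hT]
    | succ n =>
      rw [PowerSeries.coeff_rescale]
      simp only [hT, PowerSeries.coeff_succ_X_mul, 
        PowerSeries.coeff_derivative, PowerSeries.coeff_rescale]
      ring
  have hT0 : T ≠ 0 := PowerSeries.X_ne_zero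
  have f2' := mul_left_cancel₀ hT0 f2
  have f3 : (1 - T) * (T * PowerSeries.derivative F B) -
      (1 - c * T) * (T * PowerSeries.derivative F (PowerSeries.rescale q B)) =
      T * B - c * T * PowerSeries.rescale q B := by
    have h := congrArg (fun S => T * PowerSeries.derivative F S) f1
    simp only [Derivation.leibniz, map_sub, smul_eq_mul, hT, PowerSeries.derivative_X, hc, PowerSeries.derivative_C,
      Derivation.map_one_eq_zero] at h
    simp only [hT, hc]
    linear_combination h
  set G : PowerSeries F := PowerSeries.mk fun n => 1 - x ^ n with hG
  have f4 : P - PowerSeries.rescale q P = G := by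
    ext n
    simp only [hP, hG, map_sub, PowerSeries.coeff_rescale, PowerSeries.coeff_mk, zp]
    cases n with
    | zero => simp
    | succ n =>
      have : 1 - q ^ (n + 1) ≠ 0 := sub_ne_zero.mpr (hq n).symm
      field_simp
  have f5 : (1 - T) * (1 - c * T) * G = (1 - c) * T := by
    have hG2 : G = PowerSeries.mk (fun _ => (1 : F)) - PowerSeries.mk (fun n => x ^ n) := by
      ext n; simp [hG]
    have g1 : PowerSeries.mk (fun _ => (1 : F)) * (1 - T) = 1 :=
      PowerSeries.mk_one_mul_one_sub_eq_one F
    have g2 : PowerSeries.mk (fun n => x ^ n) * (1 - c * T) = 1 := by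
      ext n
      rw [mul_comm, sub_mul, map_sub, mul_assoc, PowerSeries.coeff_C_mul]
      cases n with
      | zero => simp [hT]
      | succ n =>
        simp [hT, PowerSeries.coeff_succ_X_mul, PowerSeries.coeff_one]
        ring
    rw [hG2]
    linear_combination (1 - c * T) * g1 - (1 - T) * g2
  have hcT : (1 - c * T) ≠ 0 := by
    intro h
    have := congrArg (PowerSeries.coeff 0) h
    simp [hT] at this
  have f6 : (1 - T) * G * B = T * B - c * T * PowerSeries.rescale q B := by
    apply mul_left_cancel₀ hcT
    linear_combination B * f5 - c * T * f1
  refine sub_eq_zero.mp (series_unique x q hq _ ?_ ?_)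
  · simp [hT, hP, zp]
  · rw [map_sub, map_mul _ P B, f2']
    linear_combination f3 - f6 - (1 - T) * B * f4 - PowerSeries.rescale q P * f1

lemma zb_rec {F : Type*} [Field F] (x q : F) (hq : ∀ k : ℕ, q ^ (k + 1) ≠ 1) (n : ℕ) :
    (n : F) * zb x q n = ∑ k ∈ Finset.range n, zp x q (k + 1) * zb x q (n - 1 - k) := by
  cases n with
  | zero => simp
  | succ n =>
    have h := congrArg (PowerSeries.coeff (n + 1)) (zb_series x q hq)
    rw [PowerSeries.coeff_succ_X_mul, PowerSeries.coeff_mul, 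
      Finset.Nat.sum_antidiagonal_eq_sum_range_succ_mk, Finset.sum_range_succ'] at h
    simp only [PowerSeries.coeff_derivative, PowerSeries.coeff_mk] at h
    rw [mul_comm]
    push_cast
    rw [h]
    simp only [zp, pow_zero, sub_self, zero_div, zero_mul, add_zero]
    apply Finset.sum_congr rfl
    intro k _
    congr 2
    omega

lemma za_eq_zb {F : Type*} [Field F] [CharZero F] (x q : F) (hq : ∀ k : ℕ, q ^ (k + 1) ≠ 1)
    (n : ℕ) : za (zp x q) n = zb x q n := by
  induction n using Nat.strong_induction_on with
  | _ n ih =>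
    by_cases hn : n = 0
    · subst hn
      simp [za, zb, zw]
    · have h : (n : F) ≠ 0 := Nat.cast_ne_zero.mpr hn
      apply mul_left_cancel₀ h
      rw [za_rec, zb_rec x q hq]
      apply Finset.sum_congr rfl
      intro k hk
      rw [ih (n - 1 - k) (by omega)]



lemma frac_smul (c : ℚ) (a : FractionRing (MvPolynomial (Fin 2) ℚ)) :
    c • a = algebraMap (MvPolynomial (Fin 2) ℚ) (FractionRing (MvPolynomial (Fin 2) ℚ))
      (MvPolynomial.C c) * a := by
  have := (smul_one_smul (MvPolynomial (Fin 2) ℚ) c a)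
  rw [← this, Algebra.smul_def, MvPolynomial.smul_eq_C_mul, mul_one]

/-- The `q`-binomial identity via permutations:
`(1/n!) ∑_{σ ∈ S_n} det(I - x M_σ)/det(I - q M_σ) = ∏_{k=1}^n (1 - x q^{k-1})/(1 - q^k)`,
as an identity of rational functions in the two variables `x = X 0`, `q = X 1`. -/
theorem q_binomial_via_permutations (n : ℕ) (hn : 1 ≤ n) :
    ((n.factorial : ℚ)⁻¹ : ℚ) •
        ∑ σ : Equiv.Perm (Fin n),
          (algebraMap (MvPolynomial (Fin 2) ℚ) (FractionRing (MvPolynomial (Fin 2) ℚ))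
              (Matrix.det ((1 : Matrix (Fin n) (Fin n) (MvPolynomial (Fin 2) ℚ)) -
                (MvPolynomial.X 0 : MvPolynomial (Fin 2) ℚ) •
                  σ.permMatrix (MvPolynomial (Fin 2) ℚ)))) /
          (algebraMap (MvPolynomial (Fin 2) ℚ) (FractionRing (MvPolynomial (Fin 2) ℚ))
              (Matrix.det ((1 : Matrix (Fin n) (Fin n) (MvPolynomial (Fin 2) ℚ)) -
                (MvPolynomial.X 1 : MvPolynomial (Fin 2) ℚ) •
                  σ.permMatrix (MvPolynomial (Fin 2) ℚ)))) =
      ∏ k ∈ Finset.range n,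
        (1 - algebraMap (MvPolynomial (Fin 2) ℚ) (FractionRing (MvPolynomial (Fin 2) ℚ))
              (MvPolynomial.X 0 : MvPolynomial (Fin 2) ℚ) *
            algebraMap (MvPolynomial (Fin 2) ℚ) (FractionRing (MvPolynomial (Fin 2) ℚ))
              (MvPolynomial.X 1 : MvPolynomial (Fin 2) ℚ) ^ k) /
          (1 - algebraMap (MvPolynomial (Fin 2) ℚ) (FractionRing (MvPolynomial (Fin 2) ℚ))
              (MvPolynomial.X 1 : MvPolynomial (Fin 2) ℚ) ^ (k + 1)) := by
  set K := FractionRing (MvPolynomial (Fin 2) ℚ) with hK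
  set φ := algebraMap (MvPolynomial (Fin 2) ℚ) K with hφ
  have hinj : Function.Injective φ := IsFractionRing.injective (MvPolynomial (Fin 2) ℚ) K
  have hq : ∀ k : ℕ, (φ (MvPolynomial.X 1)) ^ (k + 1) ≠ 1 := by
    intro k h
    rw [← map_pow, ← map_one φ] at h
    have h1 := congrArg (MvPolynomial.eval (fun _ => (0 : ℚ))) (hinj h)
    simp at h1
  have hdet : ∀ (σ : Equiv.Perm (Fin n)) (i : Fin 2),
      φ (Matrix.det ((1 : Matrix (Fin n) (Fin n) (MvPolynomial (Fin 2) ℚ)) -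
        (MvPolynomial.X i : MvPolynomial (Fin 2) ℚ) • σ.permMatrix (MvPolynomial (Fin 2) ℚ))) =
      (σ.partition.parts.map fun k => 1 - φ (MvPolynomial.X i) ^ k).prod := by
    intro σ i
    rw [permMat_det, map_multiset_prod, Multiset.map_map]
    simp
  have hmain := perm_sum (zp (φ (MvPolynomial.X 0)) (φ (MvPolynomial.X 1))) (α := Fin n)
  rw [za_eq_zb _ _ hq] at hmain
  conv_rhs at hmain => rw [Fintype.card_fin]
  simp only [hdet]
  have hz : ∀ σ : Equiv.Perm (Fin n),
      (σ.partition.parts.map fun k => 1 - φ (MvPolynomial.X 0) ^ k).prod /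
      (σ.partition.parts.map fun k => 1 - φ (MvPolynomial.X 1) ^ k).prod =
      (σ.partition.parts.map (zp (φ (MvPolynomial.X 0)) (φ (MvPolynomial.X 1)))).prod := by
    intro σ
    rw [← Multiset.prod_map_div]
    rfl
  rw [Finset.sum_congr rfl fun σ _ => hz σ, hmain, frac_smul, ← mul_assoc]
  have hinv : φ (MvPolynomial.C ((n.factorial : ℚ)⁻¹)) * (n.factorial : K) = 1 := by
    rw [← map_natCast φ, ← map_natCast (MvPolynomial.C : ℚ →+* MvPolynomial (Fin 2) ℚ),
      ← map_mul, ← map_mul,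
      inv_mul_cancel₀ (Nat.cast_ne_zero.mpr (Nat.factorial_ne_zero n)), map_one, map_one]
  rw [hinv, one_mul]
  rfl
end
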